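/- For all natural numbers s ≥ 1 and r ≥ 1, the sum over all ordered pairs (P, Q) of Dyck words of semilength s of the integer (2s − 1)·r² − (number of nestings of P) − (number of nestings of Q) equals ((2s − 1)·r² − s − 1)·(C_s)². In particular, the expected number of twist regions of a random (r, 2s−1)-meander link diagram is (2s − 1)·r² − s − 1, which for r = 1 is s − 2. -/

import Mathlib

/-- A Dyck word, encoded as a list of booleans where `true` stands for `'('` and
`false` stands for `')'`: the total numbers of `'('` and `')'` agree, and every
prefix contains at least as many `'('` as `')'`. -/
def IsDyckList (w : List Bool) : Prop :=
  w.count true = w.count false ∧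
  ∀ n : ℕ, (w.take n).count false ≤ (w.take n).count true

/-- The number of nestings of a word: occurrences of a `'('` immediately followed
by a `')'`. -/
def nestingCount (w : List Bool) : ℕ :=
  (w.zip w.tail).count (true, false)

namespace DyckStep

/-- The encoding of a step as a boolean: `true` for `U` and `false` for `D`. -/
def toBool : DyckStep → Bool
  | U => true
  | D => false

/-- The step encoded by a boolean. -/
def ofBool : Bool → DyckStep
  | true => U
  | false => D

lemma toBool_ofBool (b : Bool) : (ofBool b).toBool = b := by cases b <;> rfl

lemma ofBool_injective : Function.Injective ofBool :=
  Function.LeftInverse.injective toBool_ofBool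

lemma toBool_injective : Function.Injective toBool := by
  rintro (_ | _) (_ | _) h <;> simp_all [toBool]

end DyckStep

lemma DyckWord.isDyckList_map_toBool (p : DyckWord) :
    IsDyckList (p.toList.map DyckStep.toBool) := by
  have hU (l : List DyckStep) : (l.map DyckStep.toBool).count true = l.count .U :=
    List.count_map_of_injective l _ DyckStep.toBool_injective .U
  have hD (l : List DyckStep) : (l.map DyckStep.toBool).count false = l.count .D :=
    List.count_map_of_injective l _ DyckStep.toBool_injective .D
  refine ⟨by rw [hU, hD, p.count_U_eq_count_D], fun n ↦ ?_⟩
  rw [← List.map_take, hU, hD]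
  exact p.count_D_le_count_U n

/-- The Dyck word encoded by a list of booleans. -/
def IsDyckList.toDyckWord {w : List Bool} (h : IsDyckList w) : DyckWord where
  toList := w.map DyckStep.ofBool
  count_U_eq_count_D :=
    (List.count_map_of_injective w _ DyckStep.ofBool_injective true).trans
      (h.1.trans (List.count_map_of_injective w _ DyckStep.ofBool_injective false).symm)
  count_D_le_count_U n := by
    rw [← List.map_take]
    exact (List.count_map_of_injective _ _ DyckStep.ofBool_injective false).le.trans
      ((h.2 n).trans (List.count_map_of_injective _ _ DyckStep.ofBool_injective true).ge)

lemma nestingCount_cons_cons (a b : Bool) (l : List Bool) :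
    nestingCount (a :: b :: l) = nestingCount (b :: l) + if a && !b then 1 else 0 := by
  cases a <;> cases b <;> simp [nestingCount]

lemma nestingCount_false_cons (l : List Bool) : nestingCount (false :: l) = nestingCount l := by
  cases l with
  | nil => rfl
  | cons b l => simp [nestingCount_cons_cons]

namespace BinaryTree

/-- The boolean encoding of the Dyck word corresponding to a binary tree. -/
def toBoolWord : BinaryTree Unit → List Bool
  | nil => []
  | node _ l r => true :: l.toBoolWord ++ false :: r.toBoolWord

lemma toBoolWord_eq_map (t : BinaryTree Unit) :
    t.toBoolWord = (DyckWord.ofTree t).toList.map DyckStep.toBool := by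
  induction t with
  | nil => rfl
  | node a l r hl hr =>
    have h : (DyckWord.ofTree (node a l r)).toList =
      ([.U] ++ (DyckWord.ofTree l).toList ++ [.D]) ++ (DyckWord.ofTree r).toList := rfl
    simp [h, toBoolWord, hl, hr, DyckStep.toBool]

lemma length_toBoolWord (t : BinaryTree Unit) : t.toBoolWord.length = 2 * t.numNodes := by
  induction t with
  | nil => rfl
  | node a l r hl hr =>
    simp only [toBoolWord, numNodes, List.length_append, List.length_cons, hl, hr]
    ring

lemma toBoolWord_injective : Function.Injective toBoolWord := by
  intro t u h
  rw [toBoolWord_eq_map, toBoolWord_eq_map] at h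
  exact DyckWord.equivTree.symm.injective
    (DyckWord.ext (List.map_injective_iff.mpr DyckStep.toBool_injective h))

lemma image_toBoolWord (n : ℕ) :
    toBoolWord '' (treesOfNumNodesEq n : Set (BinaryTree Unit)) =
      {w : List Bool | w.length = 2 * n ∧ IsDyckList w} := by
  ext w
  simp only [coe_treesOfNumNodesEq, Set.mem_image, Set.mem_ofPred_eq]
  constructor
  · rintro ⟨t, rfl, rfl⟩
    refine ⟨length_toBoolWord t, ?_⟩
    rw [toBoolWord_eq_map]
    exact DyckWord.isDyckList_map_toBool _
  · rintro ⟨hn, hw⟩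
    have h : hw.toDyckWord.toTree.toBoolWord = w := by
      rw [toBoolWord_eq_map, DyckWord.ofTree_toTree]
      simp [IsDyckList.toDyckWord, Function.comp_def, DyckStep.toBool_ofBool]
    refine ⟨_, ?_, h⟩
    have := length_toBoolWord hw.toDyckWord.toTree
    rw [h] at this
    omega

/-- The number of nodes whose left child is empty. -/
def numLeftNil : BinaryTree Unit → ℕ
  | nil => 0
  | node _ nil r => 1 + r.numLeftNil
  | node _ (node a l₁ l₂) r => (node a l₁ l₂).numLeftNil + r.numLeftNil

/-- The mirror image of a binary tree. -/
def mirror : BinaryTree Unit → BinaryTree Unit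
  | nil => nil
  | node a l r => node a r.mirror l.mirror

lemma mirror_mirror (t : BinaryTree Unit) : t.mirror.mirror = t := by
  induction t with
  | nil => rfl
  | node a l r hl hr => simp [mirror, hl, hr]

lemma numNodes_mirror (t : BinaryTree Unit) : t.mirror.numNodes = t.numNodes := by
  induction t with
  | nil => rfl
  | node a l r hl hr => simp [mirror, numNodes, hl, hr, add_comm]

lemma numLeftNil_add_numLeftNil_mirror {t : BinaryTree Unit} (ht : t ≠ nil) :
    t.numLeftNil + t.mirror.numLeftNil = t.numNodes + 1 := by
  induction t with
  | nil => exact absurd rfl ht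
  | node a l r hl hr =>
    cases l <;> cases r <;> simp [mirror, numLeftNil, numNodes] at * <;> omega

lemma nestingCount_toBoolWord_append (t : BinaryTree Unit) (m : List Bool) :
    nestingCount (t.toBoolWord ++ m) = t.numLeftNil + nestingCount m := by
  induction t generalizing m with
  | nil => simp [toBoolWord, numLeftNil]
  | node a l r hl hr =>
    cases l with
    | nil =>
      simp only [toBoolWord, numLeftNil, List.cons_append, List.nil_append,
        nestingCount_cons_cons, nestingCount_false_cons, hr]
      simp
      ring
    | node b l₁ l₂ =>
      have h := hl (false :: (r.toBoolWord ++ m))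
      simp only [nestingCount_false_cons, hr] at h
      simp only [toBoolWord, numLeftNil, List.cons_append, List.append_assoc] at h ⊢
      rw [nestingCount_cons_cons, h]
      simp
      ring

lemma nestingCount_toBoolWord (t : BinaryTree Unit) :
    nestingCount t.toBoolWord = t.numLeftNil := by
  simpa [nestingCount] using nestingCount_toBoolWord_append t []

lemma two_mul_sum_numLeftNil {n : ℕ} (hn : 1 ≤ n) :
    2 * ∑ t ∈ treesOfNumNodesEq n, t.numLeftNil = (n + 1) * catalan n := by
  have h : ∑ t ∈ treesOfNumNodesEq n, t.mirror.numLeftNil =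
      ∑ t ∈ treesOfNumNodesEq n, t.numLeftNil :=
    Finset.sum_nbij' mirror mirror (by simp [numNodes_mirror]) (by simp [numNodes_mirror])
      (fun t _ ↦ mirror_mirror t) (fun t _ ↦ mirror_mirror t) (fun _ _ ↦ rfl)
  rw [two_mul]
  nth_rw 2 [← h]
  rw [← Finset.sum_add_distrib, ← treesOfNumNodesEq_card_eq_catalan, mul_comm, ← smul_eq_mul,
    ← Finset.sum_const]
  refine Finset.sum_congr rfl fun t ht ↦ ?_
  rw [mem_treesOfNumNodesEq] at ht
  subst ht
  refine numLeftNil_add_numLeftNil_mirror ?_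
  rintro rfl
  simp at hn

end BinaryTree

lemma finsum_mem_isDyckList {M : Type*} [AddCommMonoid M] (n : ℕ) (f : List Bool → M) :
    ∑ᶠ w ∈ {w : List Bool | w.length = 2 * n ∧ IsDyckList w}, f w =
      ∑ t ∈ BinaryTree.treesOfNumNodesEq n, f t.toBoolWord := by
  rw [← BinaryTree.image_toBoolWord, finsum_mem_image BinaryTree.toBoolWord_injective.injOn,
    finsum_mem_coe_finset]

/-- For all `s ≥ 1` and `r ≥ 1`, the sum over all ordered pairs
`(P, Q)` of Dyck words of semilength `s` of the integer
`(2s - 1) r² - (nestings of P) - (nestings of Q)` equals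
`((2s - 1) r² - s - 1) * C_s²`. In particular, the expected number of twist regions
of a random `(r, 2s-1)`-meander link diagram is `(2s - 1) r² - s - 1`, which for
`r = 1` is `s - 2`. -/
theorem expected_twist_regions (s r : ℕ) (hs : 1 ≤ s) (hr : 1 ≤ r) :
    ∑ᶠ P ∈ {w : List Bool | w.length = 2 * s ∧ IsDyckList w},
      ∑ᶠ Q ∈ {w : List Bool | w.length = 2 * s ∧ IsDyckList w},
        ((2 * (s : ℤ) - 1) * (r : ℤ) ^ 2 - nestingCount P - nestingCount Q)
      = ((2 * (s : ℤ) - 1) * (r : ℤ) ^ 2 - s - 1) * (catalan s : ℤ) ^ 2 := by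
  have h : 2 * ∑ t ∈ BinaryTree.treesOfNumNodesEq s, (t.numLeftNil : ℤ) =
      (s + 1) * catalan s := mod_cast BinaryTree.two_mul_sum_numLeftNil hs
  simp only [finsum_mem_isDyckList, BinaryTree.nestingCount_toBoolWord, Finset.sum_sub_distrib,
    Finset.sum_const, BinaryTree.treesOfNumNodesEq_card_eq_catalan, nsmul_eq_mul, ← Finset.mul_sum]
  linear_combination (-(catalan s : ℤ)) * h
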